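/- For every fixed integer s ≥ 1, the phase-quantized channel capacity is nondecreasing in the SNR: for all 0 ≤ ν₁ ≤ ν₂, C_φ(s,ν₁) ≤ C_φ(s,ν₂); equivalently, ν ↦ w_{2s}(ν, π/(2s)) is nonincreasing on [0,∞). -/

import Mathlib

open Real MeasureTheory Filter

/-- The Gaussian Q-function `Q(x) = ∫_x^∞ (2π)^{-1/2} e^{-t²/2} dt`. -/
noncomputable def gaussQ (x : ℝ) : ℝ :=
  ∫ t in Set.Ioi x, (Real.sqrt (2 * Real.pi))⁻¹ * Real.exp (-t ^ 2 / 2)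

/-- The conditional phase density `f(φ|ν)`. -/
noncomputable def phaseDensity (ν φ : ℝ) : ℝ :=
  Real.exp (-ν) / (2 * Real.pi) +
    Real.sqrt ν * Real.cos φ * Real.exp (-ν * Real.sin φ ^ 2) / Real.sqrt Real.pi *
      (1 - gaussQ (Real.sqrt (2 * ν) * Real.cos φ))

/-- The phase quantization probability function `W_y^{(K)}(ν,θ)`. -/
noncomputable def Wq (K : ℕ) (ν θ : ℝ) (y : ℕ) : ℝ :=
  ∫ φ in (2 * Real.pi / K * y - Real.pi - θ)..(2 * Real.pi / K * (y + 1) - Real.pi - θ),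
    phaseDensity ν φ

/-- The phase quantization entropy `w_K(ν,θ)` (base-2 logs; `0 · log₂ 0 = 0` since
`Real.logb 2 0 = 0`). -/
noncomputable def wEnt (K : ℕ) (ν θ : ℝ) : ℝ :=
  -∑ y ∈ Finset.range K, Wq K ν θ y * Real.logb 2 (Wq K ν θ y)

/-- The capacity `C_φ(s,ν)` of a Gaussian channel with `2s`-sector phase quantization. -/
noncomputable def Cphi (s : ℕ) (ν : ℝ) : ℝ :=
  if 1 ≤ s then Real.logb 2 (2 * s) - wEnt (2 * s) ν (Real.pi / (2 * s)) else 0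

/-- The unnormalised Gaussian mass of `(-x, ∞)`. -/
noncomputable def gaussMass (x : ℝ) : ℝ := ∫ u in Set.Ioi (-x), Real.exp (-u ^ 2)

theorem integrable_exp_neg_sq : Integrable fun u : ℝ => Real.exp (-u ^ 2) := by
  simpa using integrable_exp_neg_mul_sq (b := 1) one_pos

theorem integrable_mul_exp_neg_sq : Integrable fun u : ℝ => u * Real.exp (-u ^ 2) := by
  simpa using integrable_mul_exp_neg_mul_sq (b := 1) one_pos

theorem integral_Ioi_comp_sub_right (f : ℝ → ℝ) (x : ℝ) :
    ∫ r in Set.Ioi 0, f (r - x) = ∫ u in Set.Ioi (-x), f u := by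
  have := (measurePreserving_sub_right volume x).setIntegral_preimage_emb
    (MeasurableEquiv.subRight x).measurableEmbedding f (Set.Ioi (-x))
  simpa using this

theorem hasDerivAt_gaussMass (x : ℝ) : HasDerivAt gaussMass (Real.exp (-x ^ 2)) x := by
  have h : gaussMass = fun y => gaussMass 0 + ∫ u in (0 : ℝ)..y, Real.exp (-u ^ 2) := by
    ext y
    have hi := integrable_exp_neg_sq
    have h1 := intervalIntegral.integral_Ioi_sub_Ioi' (a := -y) (b := -0) hi.integrableOn hi.integrableOn
    have h2 := intervalIntegral.integral_comp_neg (a := 0) (b := y) fun u : ℝ => Real.exp (-u ^ 2)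
    simp only [neg_sq] at h2
    rw [h2, ← h1]
    simp only [gaussMass]
    ring
  rw [h]
  exact ((by fun_prop : Continuous fun u : ℝ => Real.exp (-u ^ 2)).integral_hasStrictDerivAt
    0 x).hasDerivAt.const_add _

theorem continuous_gaussMass : Continuous gaussMass :=
  continuous_iff_continuousAt.2 fun x => (hasDerivAt_gaussMass x).continuousAt

theorem gaussMass_nonneg (x : ℝ) : 0 ≤ gaussMass x :=
  setIntegral_nonneg measurableSet_Ioi fun _ _ => (Real.exp_pos _).le

theorem one_sub_gaussQ (x : ℝ) :
    1 - gaussQ (Real.sqrt 2 * x) = gaussMass x / Real.sqrt Real.pi := by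
  have hi := integrable_exp_neg_sq
  have hπ : 0 < Real.sqrt Real.pi := Real.sqrt_pos.2 Real.pi_pos
  have h2 : 0 < Real.sqrt 2 := by positivity
  have htot : (∫ u in Set.Iic x, Real.exp (-u ^ 2)) + ∫ u in Set.Ioi x, Real.exp (-u ^ 2)
      = Real.sqrt Real.pi := by
    rw [intervalIntegral.integral_Iic_add_Ioi hi.integrableOn hi.integrableOn]
    simpa using integral_gaussian 1
  have hneg := integral_comp_neg_Iic x fun u : ℝ => Real.exp (-u ^ 2)
  simp only [neg_sq] at hneg
  have hQ : gaussQ (Real.sqrt 2 * x) =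
      (Real.sqrt Real.pi)⁻¹ * ∫ u in Set.Ioi x, Real.exp (-u ^ 2) := by
    rw [gaussQ, ← integral_comp_mul_left_Ioi' _ _ h2, integral_const_mul, smul_eq_mul, ← mul_assoc,
      Real.sqrt_mul zero_le_two]
    congr 1
    · field_simp
    · refine integral_congr_ae (ae_of_all _ fun u => ?_)
      simp only [mul_pow, Real.sq_sqrt zero_le_two]
      congr 1
      ring
  rw [hQ, gaussMass, ← hneg, ← htot]
  rw [← htot] at hπ
  field_simp
  ring

/-- The radial factor of the phase density. -/
noncomputable def radialMass (x : ℝ) : ℝ :=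
  ∫ r in Set.Ioi 0, r * Real.exp (-r ^ 2 + 2 * r * x)

theorem radial_integrand_eq (x r : ℝ) : r * Real.exp (-r ^ 2 + 2 * r * x) =
    Real.exp (x ^ 2) * ((r - x) * Real.exp (-(r - x) ^ 2) + x * Real.exp (-(r - x) ^ 2)) := by
  have : -r ^ 2 + 2 * r * x = x ^ 2 + -(r - x) ^ 2 := by ring
  rw [this, Real.exp_add]
  ring

theorem integrable_radial (x : ℝ) : Integrable fun r => r * Real.exp (-r ^ 2 + 2 * r * x) := by
  simp only [radial_integrand_eq x]
  exact ((integrable_mul_exp_neg_sq.add (integrable_exp_neg_sq.const_mul x)).comp_sub_right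
    x).const_mul _

theorem radialMass_eq (x : ℝ) :
    radialMass x = 1 / 2 + x * Real.exp (x ^ 2) * gaussMass x := by
  have hlin : ∫ u in Set.Ioi (-x), u * Real.exp (-u ^ 2) = Real.exp (-x ^ 2) / 2 := by
    have hd : ∀ u ∈ Set.Ici (-x), HasDerivAt (fun u : ℝ => -Real.exp (-u ^ 2) / 2)
        (u * Real.exp (-u ^ 2)) u := fun u _ => by
      have := ((hasDerivAt_pow 2 u).neg.exp.neg).div_const 2
      refine this.congr_deriv ?_
      simp
      ring
    have ht : Tendsto (fun u : ℝ => -Real.exp (-u ^ 2) / 2) atTop (nhds 0) := by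
      have h := Real.tendsto_exp_atBot.comp
        (tendsto_neg_atTop_atBot.comp (tendsto_pow_atTop (α := ℝ) two_ne_zero))
      simpa using (h.neg.div_const 2)
    rw [integral_Ioi_of_hasDerivAt_of_tendsto' hd integrable_mul_exp_neg_sq.integrableOn ht]
    simp
    ring
  simp only [radialMass, radial_integrand_eq x]
  rw [integral_const_mul, integral_Ioi_comp_sub_right fun u : ℝ =>
    u * Real.exp (-u ^ 2) + x * Real.exp (-u ^ 2),
    integral_add integrable_mul_exp_neg_sq.integrableOn
      (integrable_exp_neg_sq.const_mul x).integrableOn, hlin, integral_const_mul, ← gaussMass,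
    Real.exp_neg]
  have := Real.exp_pos (x ^ 2)
  field_simp

theorem radialMass_mono : Monotone radialMass := fun x y hxy =>
  setIntegral_mono_on (integrable_radial x).integrableOn (integrable_radial y).integrableOn
    measurableSet_Ioi fun r (hr : 0 < r) => by gcongr

theorem radialMass_pos (x : ℝ) : 0 < radialMass x := by
  rw [radialMass, setIntegral_pos_iff_support_of_nonneg_ae _ (integrable_radial x).integrableOn]
  · have : (Function.support fun r => r * Real.exp (-r ^ 2 + 2 * r * x)) ∩ Set.Ioi 0
        = Set.Ioi 0 := Set.inter_eq_right.2 fun r (hr : 0 < r) => by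
      simpa using hr.ne'
    rw [this]
    simp
  · exact (ae_restrict_mem measurableSet_Ioi).mono fun r (hr : 0 < r) => by
      simp only [Pi.zero_apply]; positivity

/-- The amplitude kernel: `√ν ↦ √ν cos φ · phaseKernel` is the second term of the phase density. -/
noncomputable def phaseKernel (b φ : ℝ) : ℝ :=
  Real.exp (-(b * Real.sin φ) ^ 2) / Real.pi * gaussMass (b * Real.cos φ)

theorem continuous_phaseKernel : Continuous (Function.uncurry phaseKernel) := by
  have := continuous_gaussMass
  simp only [Function.uncurry_def, phaseKernel]
  fun_prop

theorem phaseKernel_nonneg (b φ : ℝ) : 0 ≤ phaseKernel b φ :=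
  mul_nonneg (div_nonneg (Real.exp_pos _).le Real.pi_pos.le) (gaussMass_nonneg _)

theorem phaseDensity_sq {b : ℝ} (hb : 0 ≤ b) (φ : ℝ) : phaseDensity (b ^ 2) φ =
    Real.exp (-b ^ 2) / (2 * Real.pi) + b * Real.cos φ * phaseKernel b φ := by
  have hs : 0 < Real.sqrt Real.pi := Real.sqrt_pos.2 Real.pi_pos
  rw [phaseDensity, Real.sqrt_mul zero_le_two, Real.sqrt_sq hb, mul_assoc (Real.sqrt 2),
    one_sub_gaussQ, phaseKernel]
  have : -b ^ 2 * Real.sin φ ^ 2 = -(b * Real.sin φ) ^ 2 := by ring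
  rw [this]
  congr 1
  field_simp
  rw [Real.sq_sqrt Real.pi_pos.le]
  ring

theorem exp_sin_eq (b φ : ℝ) : Real.exp (-(b * Real.sin φ) ^ 2) =
    Real.exp (-b ^ 2) * Real.exp ((b * Real.cos φ) ^ 2) := by
  rw [← Real.exp_add]
  congr 1
  rw [mul_pow, mul_pow, Real.sin_sq]
  ring

theorem phaseDensity_sq_eq_radialMass {b : ℝ} (hb : 0 ≤ b) (φ : ℝ) :
    phaseDensity (b ^ 2) φ = Real.exp (-b ^ 2) / Real.pi * radialMass (b * Real.cos φ) := by
  rw [phaseDensity_sq hb, radialMass_eq, phaseKernel, exp_sin_eq]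
  field_simp

theorem phaseDensity_pos {ν : ℝ} (hν : 0 ≤ ν) (φ : ℝ) : 0 < phaseDensity ν φ := by
  rw [← Real.sq_sqrt hν, phaseDensity_sq_eq_radialMass (Real.sqrt_nonneg ν)]
  exact mul_pos (div_pos (Real.exp_pos _) Real.pi_pos) (radialMass_pos _)

theorem phaseDensity_le_of_cos_le {ν : ℝ} (hν : 0 ≤ ν) {φ ψ : ℝ}
    (h : Real.cos φ ≤ Real.cos ψ) : phaseDensity ν φ ≤ phaseDensity ν ψ := by
  rw [← Real.sq_sqrt hν]
  simp only [phaseDensity_sq_eq_radialMass (Real.sqrt_nonneg ν)]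
  have := Real.pi_pos
  gcongr
  exact radialMass_mono (by gcongr)

theorem continuous_phaseDensity {ν : ℝ} (hν : 0 ≤ ν) : Continuous (phaseDensity ν) := by
  have := continuous_phaseKernel
  have h : phaseDensity ν = fun φ => Real.exp (-Real.sqrt ν ^ 2) / (2 * Real.pi) +
      Real.sqrt ν * Real.cos φ * Function.uncurry phaseKernel (Real.sqrt ν, φ) := by
    ext φ
    simpa only [Real.sq_sqrt hν, Function.uncurry_apply_pair] using
      phaseDensity_sq (Real.sqrt_nonneg ν) φ
  rw [h]
  fun_prop

theorem phaseDensity_periodic (ν : ℝ) : Function.Periodic (phaseDensity ν) (2 * Real.pi) :=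
  fun φ => by simp [phaseDensity]

/-- The derivative of the phase density with respect to the amplitude `√ν`. -/
noncomputable def phaseDensityDeriv (b φ : ℝ) : ℝ :=
  (Real.cos φ - 2 * b ^ 2 * Real.sin φ ^ 2 * Real.cos φ) * phaseKernel b φ -
    b * Real.sin φ ^ 2 * Real.exp (-b ^ 2) / Real.pi

theorem continuous_phaseDensityDeriv : Continuous (Function.uncurry phaseDensityDeriv) := by
  have h : Function.uncurry phaseDensityDeriv = fun p : ℝ × ℝ =>
      (Real.cos p.2 - 2 * p.1 ^ 2 * Real.sin p.2 ^ 2 * Real.cos p.2) *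
        Function.uncurry phaseKernel p - p.1 * Real.sin p.2 ^ 2 * Real.exp (-p.1 ^ 2) / Real.pi :=
    rfl
  have := continuous_phaseKernel
  rw [h]
  fun_prop

theorem exp_mul_exp_cos (b φ : ℝ) : Real.exp (-(b * Real.sin φ) ^ 2) *
    Real.exp (-(b * Real.cos φ) ^ 2) = Real.exp (-b ^ 2) := by
  rw [exp_sin_eq, mul_assoc, ← Real.exp_add]
  simp

theorem hasDerivAt_phaseKernel_left (b φ : ℝ) : HasDerivAt (fun b => phaseKernel b φ)
    (-2 * b * Real.sin φ ^ 2 * phaseKernel b φ + Real.cos φ * Real.exp (-b ^ 2) / Real.pi) b := by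
  have hs : HasDerivAt (fun b : ℝ => b * Real.sin φ) (Real.sin φ) b := by
    simpa using (hasDerivAt_id b).mul_const (Real.sin φ)
  have hc : HasDerivAt (fun b : ℝ => b * Real.cos φ) (Real.cos φ) b := by
    simpa using (hasDerivAt_id b).mul_const (Real.cos φ)
  have hG := (hasDerivAt_gaussMass (b * Real.cos φ)).comp b hc
  have := ((hs.pow 2).neg.exp.div_const Real.pi).mul hG
  refine this.congr_deriv ?_
  rw [← exp_mul_exp_cos b φ]
  simp [phaseKernel]
  ring

theorem hasDerivAt_phaseKernel_right (b φ : ℝ) : HasDerivAt (fun φ => phaseKernel b φ)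
    (-2 * b ^ 2 * Real.sin φ * Real.cos φ * phaseKernel b φ -
      b * Real.sin φ * Real.exp (-b ^ 2) / Real.pi) φ := by
  have hs := (Real.hasDerivAt_sin φ).const_mul b
  have hc := (Real.hasDerivAt_cos φ).const_mul b
  have hG := (hasDerivAt_gaussMass (b * Real.cos φ)).comp φ hc
  have := ((hs.pow 2).neg.exp.div_const Real.pi).mul hG
  refine this.congr_deriv ?_
  rw [← exp_mul_exp_cos b φ]
  simp [phaseKernel]
  ring

theorem hasDerivAt_amplitude (b φ : ℝ) : HasDerivAt
    (fun b => Real.exp (-b ^ 2) / (2 * Real.pi) + b * Real.cos φ * phaseKernel b φ)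
    (phaseDensityDeriv b φ) b := by
  have h1 := (hasDerivAt_pow 2 b).neg.exp.div_const (2 * Real.pi)
  have h2 := ((hasDerivAt_id b).mul_const (Real.cos φ)).mul (hasDerivAt_phaseKernel_left b φ)
  refine (h1.add h2).congr_deriv ?_
  have := Real.pi_ne_zero
  simp only [phaseDensityDeriv, Real.sin_sq, id]
  field_simp
  simp
  ring

/-- The flux of the amplitude derivative through a phase ray. -/
theorem hasDerivAt_flux (b φ : ℝ) :
    HasDerivAt (fun φ => Real.sin φ * phaseKernel b φ) (phaseDensityDeriv b φ) φ := by
  refine ((Real.hasDerivAt_sin φ).mul (hasDerivAt_phaseKernel_right b φ)).congr_deriv ?_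
  simp only [phaseDensityDeriv]
  ring

theorem integral_phaseDensity_sub {b₁ b₂ : ℝ} (h₁ : 0 ≤ b₁) (h₂ : 0 ≤ b₂) (u v : ℝ) :
    (∫ φ in u..v, phaseDensity (b₂ ^ 2) φ) - ∫ φ in u..v, phaseDensity (b₁ ^ 2) φ =
      Real.sin v * (∫ b in b₁..b₂, phaseKernel b v) -
        Real.sin u * ∫ b in b₁..b₂, phaseKernel b u := by
  have hK (φ : ℝ) : Continuous fun b => phaseKernel b φ :=
    continuous_phaseKernel.comp (by fun_prop : Continuous fun b : ℝ => (b, φ))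
  have hD := continuous_phaseDensityDeriv
  rw [← intervalIntegral.integral_sub
    ((continuous_phaseDensity (sq_nonneg _)).intervalIntegrable _ _)
    ((continuous_phaseDensity (sq_nonneg _)).intervalIntegrable _ _),
    ← intervalIntegral.integral_const_mul, ← intervalIntegral.integral_const_mul,
    ← intervalIntegral.integral_sub (((hK v).const_mul _).intervalIntegrable _ _)
    (((hK u).const_mul _).intervalIntegrable _ _)]
  have hL (φ : ℝ) : phaseDensity (b₂ ^ 2) φ - phaseDensity (b₁ ^ 2) φ =
      ∫ b in b₁..b₂, phaseDensityDeriv b φ := by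
    rw [phaseDensity_sq h₁, phaseDensity_sq h₂, intervalIntegral.integral_eq_sub_of_hasDerivAt
      (fun b _ => hasDerivAt_amplitude b φ) ((hD.comp
        (by fun_prop : Continuous fun b : ℝ => (b, φ))).intervalIntegrable _ _)]
  have hR (b : ℝ) : Real.sin v * phaseKernel b v - Real.sin u * phaseKernel b u =
      ∫ φ in u..v, phaseDensityDeriv b φ := by
    rw [intervalIntegral.integral_eq_sub_of_hasDerivAt (fun φ _ => hasDerivAt_flux b φ) ((hD.comp
        (by fun_prop : Continuous fun φ : ℝ => (b, φ))).intervalIntegrable _ _)]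
  simp only [hL, hR]
  refine intervalIntegral_intervalIntegral_swap ?_
  exact ((hD.comp continuous_swap).continuousOn.integrableOn_compact
    (isCompact_uIcc.prod isCompact_uIcc)).mono_set
    (Set.prod_mono Set.uIoc_subset_uIcc Set.uIoc_subset_uIcc)

/-- The left edge of the `y`-th sector when the `2s` sectors are centred at multiples of `π / s`. -/
noncomputable def sectorEdge (s y : ℕ) : ℝ := Real.pi * (2 * y - 1) / (2 * s) - Real.pi

theorem Wq_eq_integral_sectorEdge (s : ℕ) (ν : ℝ) (y : ℕ) :
    Wq (2 * s) ν (Real.pi / (2 * s)) y =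
      ∫ φ in sectorEdge s y..sectorEdge s (y + 1), phaseDensity ν φ := by
  rw [Wq]
  congr 1 <;> simp only [sectorEdge] <;> push_cast <;> ring

theorem sectorEdge_succ (s y : ℕ) : sectorEdge s (y + 1) = sectorEdge s y + Real.pi / s := by
  simp only [sectorEdge]
  push_cast
  ring

theorem sectorEdge_add {s : ℕ} (hs : 1 ≤ s) (y : ℕ) :
    sectorEdge s (2 * s + y) = sectorEdge s y + 2 * Real.pi := by
  have : (s : ℝ) ≠ 0 := by positivity
  simp only [sectorEdge]
  push_cast
  field_simp
  ring

theorem sectorEdge_nonpos {s y : ℕ} (hs : 1 ≤ s) (hy : y ≤ s) : sectorEdge s y ≤ 0 := by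
  have h0 : (0 : ℝ) < s := by positivity
  have h1 : (y : ℝ) ≤ s := by exact_mod_cast hy
  rw [sectorEdge, sub_nonpos, div_le_iff₀ (by positivity)]
  nlinarith [Real.pi_pos]

theorem neg_pi_le_sectorEdge {s y : ℕ} (hy : 1 ≤ y) : -Real.pi ≤ sectorEdge s y := by
  have h1 : (1 : ℝ) ≤ y := by exact_mod_cast hy
  have : 0 ≤ Real.pi * (2 * y - 1) / (2 * s) := by
    have := Real.pi_pos
    have : (0 : ℝ) ≤ 2 * y - 1 := by linarith
    positivity
  rw [sectorEdge]
  linarith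

theorem sin_sectorEdge_nonpos {s y : ℕ} (hs : 1 ≤ s) (h1 : 1 ≤ y) (hy : y ≤ s) :
    Real.sin (sectorEdge s y) ≤ 0 :=
  Real.sin_nonpos_of_nonpos_of_neg_pi_le (sectorEdge_nonpos hs hy) (neg_pi_le_sectorEdge h1)

theorem sin_sectorEdge_nonneg {s y : ℕ} (hs : 1 ≤ s) (h1 : s < y) (hy : y ≤ 2 * s) :
    0 ≤ Real.sin (sectorEdge s y) := by
  have h0 : (0 : ℝ) < s := by positivity
  have h2 : (s : ℝ) + 1 ≤ y := by exact_mod_cast h1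
  have h3 : (y : ℝ) ≤ 2 * s := by exact_mod_cast hy
  apply Real.sin_nonneg_of_nonneg_of_le_pi
  · rw [sectorEdge, sub_nonneg, le_div_iff₀ (by positivity)]
    nlinarith [Real.pi_pos]
  · rw [sectorEdge, sub_le_iff_le_add, div_le_iff₀ (by positivity)]
    nlinarith [Real.pi_pos]

section Sectors

variable {s : ℕ} {ν : ℝ}

theorem Wq_pos (hs : 1 ≤ s) (hν : 0 ≤ ν) (y : ℕ) : 0 < Wq (2 * s) ν (Real.pi / (2 * s)) y := by
  rw [Wq_eq_integral_sectorEdge]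
  refine intervalIntegral.intervalIntegral_pos_of_pos
    ((continuous_phaseDensity hν).intervalIntegrable _ _) (phaseDensity_pos hν) ?_
  rw [sectorEdge_succ, lt_add_iff_pos_right]
  have := Real.pi_pos
  positivity

theorem Wq_two_mul (hs : 1 ≤ s) : Wq (2 * s) ν (Real.pi / (2 * s)) (2 * s) =
    Wq (2 * s) ν (Real.pi / (2 * s)) 0 := by
  have h0 := sectorEdge_add hs 0
  have h1 := sectorEdge_add hs (0 + 1)
  rw [Wq_eq_integral_sectorEdge, Wq_eq_integral_sectorEdge, ← add_zero (2 * s), h0, add_assoc, h1,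
    ← intervalIntegral.integral_comp_add_right]
  simp only [phaseDensity_periodic ν _]

theorem Wq_succ (y : ℕ) : Wq (2 * s) ν (Real.pi / (2 * s)) (y + 1) =
    ∫ φ in sectorEdge s y..sectorEdge s (y + 1), phaseDensity ν (φ + Real.pi / s) := by
  rw [Wq_eq_integral_sectorEdge, intervalIntegral.integral_comp_add_right, ← sectorEdge_succ,
    ← sectorEdge_succ]

theorem cos_add_sub_cos (φ d : ℝ) :
    Real.cos (φ + d) - Real.cos φ = -2 * Real.sin (φ + d / 2) * Real.sin (d / 2) := by
  rw [Real.cos_sub_cos]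
  congr 3 <;> ring

theorem sin_half_step_nonneg (hs : 1 ≤ s) : 0 ≤ Real.sin (Real.pi / s / 2) := by
  have h1 : (1 : ℝ) ≤ s := by exact_mod_cast hs
  have := Real.pi_pos
  apply Real.sin_nonneg_of_nonneg_of_le_pi (by positivity)
  have : Real.pi / s ≤ Real.pi := div_le_self this.le h1
  linarith

theorem sectorEdge_add_half_step (y : ℕ) :
    sectorEdge s y + Real.pi / s / 2 = Real.pi * y / s - Real.pi := by
  simp only [sectorEdge]
  ring

theorem sectorEdge_le_succ (y : ℕ) : sectorEdge s y ≤ sectorEdge s (y + 1) := by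
  rw [sectorEdge_succ, le_add_iff_nonneg_right]
  have := Real.pi_pos
  positivity

theorem Wq_le_succ (hs : 1 ≤ s) (hν : 0 ≤ ν) {y : ℕ} (hy : y + 1 ≤ s) :
    Wq (2 * s) ν (Real.pi / (2 * s)) y ≤ Wq (2 * s) ν (Real.pi / (2 * s)) (y + 1) := by
  have hc := continuous_phaseDensity hν
  rw [Wq_succ, Wq_eq_integral_sectorEdge]
  refine intervalIntegral.integral_mono_on (sectorEdge_le_succ y) (hc.intervalIntegrable _ _)
    ((hc.comp (continuous_add_const _)).intervalIntegrable _ _) fun φ hφ =>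
      phaseDensity_le_of_cos_le hν ?_
  have h0 : (0 : ℝ) < s := by positivity
  have hlo := sectorEdge_add_half_step (s := s) y
  have hhi := sectorEdge_add_half_step (s := s) (y + 1)
  have h1 : 0 ≤ Real.pi * y / s := by
    have := Real.pi_pos
    positivity
  have h2 : Real.pi * (y + 1 : ℕ) / s ≤ Real.pi := by
    rw [div_le_iff₀ h0]
    exact mul_le_mul_of_nonneg_left (by exact_mod_cast hy) Real.pi_pos.le
  have hsin : Real.sin (φ + Real.pi / s / 2) ≤ 0 :=
    Real.sin_nonpos_of_nonpos_of_neg_pi_le (by linarith [hφ.2]) (by linarith [hφ.1])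
  have := cos_add_sub_cos φ (Real.pi / s)
  nlinarith [mul_nonneg (neg_nonneg.2 hsin) (sin_half_step_nonneg hs)]

theorem Wq_succ_le (hs : 1 ≤ s) (hν : 0 ≤ ν) {y : ℕ} (h : s ≤ y) (hy : y + 1 ≤ 2 * s) :
    Wq (2 * s) ν (Real.pi / (2 * s)) (y + 1) ≤ Wq (2 * s) ν (Real.pi / (2 * s)) y := by
  have hc := continuous_phaseDensity hν
  rw [Wq_succ, Wq_eq_integral_sectorEdge]
  refine intervalIntegral.integral_mono_on (sectorEdge_le_succ y)
    ((hc.comp (continuous_add_const _)).intervalIntegrable _ _) (hc.intervalIntegrable _ _)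
      fun φ hφ => phaseDensity_le_of_cos_le hν ?_
  have h0 : (0 : ℝ) < s := by positivity
  have hlo := sectorEdge_add_half_step (s := s) y
  have hhi := sectorEdge_add_half_step (s := s) (y + 1)
  have h1 : Real.pi ≤ Real.pi * y / s := by
    rw [le_div_iff₀ h0]
    exact mul_le_mul_of_nonneg_left (by exact_mod_cast h) Real.pi_pos.le
  have h2 : Real.pi * (y + 1 : ℕ) / s ≤ 2 * Real.pi := by
    rw [div_le_iff₀ h0, mul_comm 2, mul_assoc]
    exact mul_le_mul_of_nonneg_left (by exact_mod_cast hy) Real.pi_pos.le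
  have hsin : 0 ≤ Real.sin (φ + Real.pi / s / 2) :=
    Real.sin_nonneg_of_nonneg_of_le_pi (by linarith [hφ.1]) (by linarith [hφ.2])
  have := cos_add_sub_cos φ (Real.pi / s)
  nlinarith [mul_nonneg hsin (sin_half_step_nonneg hs)]

end Sectors

/-- Gibbs' inequality together with summation by parts around a cycle: if `q - p` is the increment
of `D` and `D (y + 1) * (log p y - log p (y + 1))` is nonnegative, then `q` has at most the entropy
of `p`. -/
theorem sum_mul_log_le_of_cyclic_increments {n : ℕ} {p q D : ℕ → ℝ} (hp : ∀ y, 0 < p y)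
    (hq : ∀ y, 0 < q y) (hD : ∀ y, q y - p y = D (y + 1) - D y) (hDn : D n = D 0)
    (hpn : p n = p 0)
    (h : ∀ y < n, 0 ≤ D (y + 1) * (Real.log (p y) - Real.log (p (y + 1)))) :
    ∑ y ∈ Finset.range n, p y * Real.log (p y) ≤ ∑ y ∈ Finset.range n, q y * Real.log (q y) := by
  have hmass : ∑ y ∈ Finset.range n, (D (y + 1) - D y) = 0 := by
    rw [Finset.sum_range_sub, hDn, sub_self]
  have hcycle : ∑ y ∈ Finset.range n,
      (D (y + 1) * Real.log (p (y + 1)) - D y * Real.log (p y)) = 0 := by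
    rw [Finset.sum_range_sub fun y => D y * Real.log (p y), hDn, hpn, sub_self]
  rw [← sub_nonneg, ← Finset.sum_sub_distrib]
  refine (Finset.sum_nonneg fun y hy => h y (Finset.mem_range.1 hy)).trans ?_
  rw [← add_zero (∑ y ∈ Finset.range n, D (y + 1) * _), ← hcycle, ← Finset.sum_add_distrib,
    ← add_zero (∑ y ∈ Finset.range n, _), ← hmass, ← Finset.sum_add_distrib]
  refine Finset.sum_le_sum fun y _ => ?_
  have hlog := Real.log_le_sub_one_of_pos (div_pos (hp y) (hq y))
  rw [Real.log_div (hp y).ne' (hq y).ne'] at hlog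
  have hgibbs := mul_le_mul_of_nonneg_left hlog (hq y).le
  have : q y * (p y / q y - 1) = -(D (y + 1) - D y) := by
    rw [← hD, mul_sub, mul_div_cancel₀ _ (hq y).ne']
    ring
  rw [this] at hgibbs
  have hlogp : (q y - p y) * Real.log (p y) = (D (y + 1) - D y) * Real.log (p y) := by rw [hD]
  linarith

theorem wEnt_antitoneOn {s : ℕ} (hs : 1 ≤ s) :
    AntitoneOn (fun ν => wEnt (2 * s) ν (Real.pi / (2 * s))) (Set.Ici 0) := by
  intro ν₁ (h₁ : 0 ≤ ν₁) ν₂ (h₂ : 0 ≤ ν₂) h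
  have hsqrt := Real.sqrt_le_sqrt h
  have hinc (y : ℕ) := integral_phaseDensity_sub (Real.sqrt_nonneg ν₁) (Real.sqrt_nonneg ν₂)
    (sectorEdge s y) (sectorEdge s (y + 1))
  simp only [Real.sq_sqrt h₁, Real.sq_sqrt h₂, ← Wq_eq_integral_sectorEdge] at hinc
  have hK (φ : ℝ) : 0 ≤ ∫ b in Real.sqrt ν₁..Real.sqrt ν₂, phaseKernel b φ :=
    intervalIntegral.integral_nonneg hsqrt fun b _ => phaseKernel_nonneg b φ
  have hlog {y z : ℕ} (hW : Wq (2 * s) ν₁ (Real.pi / (2 * s)) y ≤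
      Wq (2 * s) ν₁ (Real.pi / (2 * s)) z) := Real.log_le_log (Wq_pos hs h₁ y) hW
  have key := sum_mul_log_le_of_cyclic_increments (n := 2 * s) (Wq_pos hs h₁) (Wq_pos hs h₂)
    (D := fun y => Real.sin (sectorEdge s y) *
      ∫ b in Real.sqrt ν₁..Real.sqrt ν₂, phaseKernel b (sectorEdge s y)) hinc
    (by
      have := sectorEdge_add hs 0
      rw [add_zero] at this
      simp only [this, phaseKernel, Real.sin_add_two_pi, Real.cos_add_two_pi])
    (Wq_two_mul hs) (fun y hy => by
      rcases le_or_gt (y + 1) s with hys | hys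
      · exact mul_nonneg_of_nonpos_of_nonpos
          (mul_nonpos_of_nonpos_of_nonneg (sin_sectorEdge_nonpos hs le_add_self hys) (hK _))
          (sub_nonpos.2 (hlog (Wq_le_succ hs h₁ hys)))
      · exact mul_nonneg (mul_nonneg (sin_sectorEdge_nonneg hs hys hy) (hK _))
          (sub_nonneg.2 (hlog (Wq_succ_le hs h₁ (Nat.lt_succ_iff.1 hys) hy))))
  simp only [wEnt, Real.logb, ← mul_div_assoc, ← Finset.sum_div]
  have := Real.log_pos one_lt_two
  gcongr

/-- for fixed `s ≥ 1`, `C_φ(s,·)` is nondecreasing in the SNR; equivalently,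
`ν ↦ w_{2s}(ν, π/(2s))` is nonincreasing on `[0,∞)`. -/
theorem Cphi_monotone_in_snr (s : ℕ) (hs : 1 ≤ s) :
    ∀ ν₁ ν₂ : ℝ, 0 ≤ ν₁ → ν₁ ≤ ν₂ →
      Cphi s ν₁ ≤ Cphi s ν₂ ∧
        wEnt (2 * s) ν₂ (Real.pi / (2 * s)) ≤ wEnt (2 * s) ν₁ (Real.pi / (2 * s)) := by
  intro ν₁ ν₂ h₁ h
  have hw := wEnt_antitoneOn hs h₁ (h₁.trans h) h
  refine ⟨?_, hw⟩
  simp only [Cphi, if_pos hs]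
  exact sub_le_sub_left hw _
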